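/- There exist constants C = C(d, K) < ∞, R_0 = R_0(d, K) < ∞, and M_0 = M_0(d, K) < ∞ with the following property. Let r_+ := (φ d/(2σ_d))^{1/d} L, assume r_+ ≤ L/4, and for η ∈ [0,1] let r_η := η^{1/d}(φ d/(2σ_d))^{1/d} L and u_η(x) := v_R(|x| − r_η) + α(η), where α(η) is the constant making ⨍_Ω u_η dx = −1+φ. Then for any R ≥ R_0 and any η with r_η ≥ R and 1−η ≥ M_0 φ^2, one has | E(u_η) − [ c_0 σ_d r_η^{d−1} + φ^2 L^d (1−η)^2 − φ^3 L^d (1−η)^3 + (φ^4 L^d/4)(1−η)^4 ] | ≤ C ( r_η^{d−1} e^{−R/C} + φ(1−η) r_η^{d−2} + φ^2 (1−η)^2 r_η^{d−1} + φ^4 η (1−η)^3 L^d + r_η^{d−3} ). (Energy expansion for the fractional droplet state.) -/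

import Mathlib

open MeasureTheory Real Filter Topology

noncomputable section

/-- `Ed d` is Euclidean `d`-space. -/
abbrev Ed (d : ℕ) : Type := EuclideanSpace ℝ (Fin d)

/-- The fundamental domain `[-L/2, L/2]^d` of the flat torus of side length `L`. -/
def Box (d : ℕ) (L : ℝ) : Set (Ed d) := {x | ∀ i, x i ∈ Set.Ioc (-(L / 2)) (L / 2)}

/-- The double-well potential `G(u) = (1 - u²)² / 4`. -/
def Gpot (t : ℝ) : ℝ := (1 - t ^ 2) ^ 2 / 4

/-- The Cahn–Hilliard energy `E(u) = ∫_Ω (|∇u|²/2 + G(u)) dx`. -/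
def CHenergy (d : ℕ) (L : ℝ) (u : Ed d → ℝ) : ℝ :=
  ∫ x in Box d L, (‖gradient u x‖ ^ 2 / 2 + Gpot (u x))

/-- `σ_d`, the surface area of the unit sphere in `ℝ^d`. -/
def sphereArea (d : ℕ) : ℝ := d * (volume (Metric.ball (0 : Ed d) 1)).toReal

/-- `c₀ = 2√2/3`, the cost of a one-dimensional transition layer. -/
def c₀ : ℝ := 2 * Real.sqrt 2 / 3

/-- The one-dimensional optimal transition profile `v(t) = -tanh(t/√2)`. -/
def vprof (t : ℝ) : ℝ := -Real.tanh (t / Real.sqrt 2)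

/-- The truncated profile `v_R`: odd, smooth, nonincreasing, with values in `[-1,1]`,
equal to `v` on `(-R, R)` and to `-sgn` outside `[-2R, 2R]`, exponentially close to
`-sgn` for `|t| ≥ R` and with exponentially decaying derivative (with constant `K`). -/
def IsProfile (K R : ℝ) (w : ℝ → ℝ) : Prop :=
  ContDiff ℝ (⊤ : ℕ∞) w ∧ (∀ t, w (-t) = -w t) ∧ Antitone w ∧ (∀ t, |w t| ≤ 1) ∧
    (∀ t, |t| < R → w t = vprof t) ∧ (∀ t, 2 * R < |t| → w t = -Real.sign t) ∧
    (∀ t, R ≤ |t| → |w t + Real.sign t| ≤ K * Real.exp (-|t| / K)) ∧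
    (∀ t, |deriv w t| ≤ K * Real.exp (-|t| / K))

/-- Polynomially weighted exponentials are integrable on the line. -/
lemma integrable_one_add_abs_pow_mul_exp (n : ℕ) {k : ℝ} (hk : 0 < k) :
    Integrable (fun s : ℝ => (1 + |s|) ^ n * exp (-k * |s|)) := by
  have h1 : Integrable (fun s : ℝ => (1 + ‖s‖) ^ (-(2 : ℝ))) :=
    integrable_one_add_norm (by simp)
  refine (h1.const_mul ((n + 2).factorial / k ^ (n + 2) * exp k)).mono'
    (by fun_prop) (Eventually.of_forall fun s => ?_)
  have hs : 0 < 1 + |s| := by positivity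
  rw [Real.norm_of_nonneg (by positivity), Real.norm_eq_abs, Real.rpow_neg hs.le]
  have h2 := Real.pow_div_factorial_le_exp (k * (1 + |s|)) (by positivity) (n + 2)
  have h3 : exp (k * (1 + |s|)) * exp (-k * |s|) = exp k := by
    rw [← Real.exp_add]; ring_nf
  have h4 : (1 + |s|) ^ (n + 2) ≤ (n + 2).factorial / k ^ (n + 2) * exp (k * (1 + |s|)) := by
    rw [div_le_iff₀ (by positivity), mul_pow] at h2
    rw [div_mul_eq_mul_div, le_div_iff₀ (by positivity)]
    linarith
  have h5 : (1 + |s|) ^ (2 : ℝ) = (1 + |s|) ^ 2 := by norm_cast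
  rw [h5, ← div_eq_mul_inv, le_div_iff₀ (by positivity)]
  calc (1 + |s|) ^ n * exp (-k * |s|) * (1 + |s|) ^ 2
      = (1 + |s|) ^ (n + 2) * exp (-k * |s|) := by ring
    _ ≤ (n + 2).factorial / k ^ (n + 2) * exp (k * (1 + |s|)) * exp (-k * |s|) := by gcongr
    _ = (n + 2).factorial / k ^ (n + 2) * exp k := by rw [mul_assoc, h3]

/-- The moment constant controlling all weighted exponential integrals. -/
def expMoment (d : ℕ) (k : ℝ) : ℝ := ∫ s : ℝ, (1 + |s|) ^ (d + 1) * exp (-k * |s|)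

lemma expMoment_nonneg (d : ℕ) (k : ℝ) : 0 ≤ expMoment d k :=
  integral_nonneg fun _ => by positivity

lemma sphereArea_pos {d : ℕ} (hd : 2 ≤ d) : 0 < sphereArea d := by
  have : 0 < (volume (Metric.ball (0 : Ed d) 1)).toReal :=
    ENNReal.toReal_pos (Metric.measure_ball_pos _ _ one_pos).ne' measure_ball_lt_top.ne
  have : (0 : ℝ) < d := by exact_mod_cast (by omega : 0 < d)
  unfold sphereArea; positivity

lemma nontrivial_Ed {d : ℕ} (hd : 2 ≤ d) : Nontrivial (Ed d) := by
  have : Nonempty (Fin d) := ⟨⟨0, by omega⟩⟩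
  infer_instance

/-- Polar coordinates for radial functions on `ℝ^d`. -/
lemma integral_radial {d : ℕ} (hd : 2 ≤ d) (f : ℝ → ℝ) :
    ∫ x : Ed d, f ‖x‖ = sphereArea d * ∫ y in Set.Ioi (0 : ℝ), y ^ (d - 1) * f y := by
  have := nontrivial_Ed hd
  rw [integral_fun_norm_addHaar]
  simp [sphereArea, Measure.real, mul_assoc]

lemma integrable_radial {d : ℕ} (hd : 2 ≤ d) (f : ℝ → ℝ) :
    Integrable (fun x : Ed d => f ‖x‖) ↔
      IntegrableOn (fun y : ℝ => y ^ (d - 1) * f y) (Set.Ioi 0) := by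
  have := nontrivial_Ed hd
  rw [integrable_fun_norm_addHaar volume (f := f)]
  simp

/-- Layers of exponentially small width around a sphere of radius `r ≥ 1` have mass of order
`r^{d-1}`. -/
lemma integral_exp_layer {d : ℕ} (hd : 2 ≤ d) {k : ℝ} (hk : 0 < k) {r : ℝ} (hr : 1 ≤ r) :
    Integrable (fun x : Ed d => exp (-k * |‖x‖ - r|)) ∧
      ∫ x : Ed d, exp (-k * |‖x‖ - r|) ≤ sphereArea d * expMoment d k * r ^ (d - 1) := by
  have hM := (integrable_one_add_abs_pow_mul_exp (d + 1) hk).comp_sub_right r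
  have hM' := hM.const_mul (r ^ (d - 1))
  have hb : ∀ y ∈ Set.Ioi (0 : ℝ), y ^ (d - 1) * exp (-k * |y - r|) ≤
      r ^ (d - 1) * ((1 + |y - r|) ^ (d + 1) * exp (-k * |y - r|)) := by
    intro y hy
    have hy : (0 : ℝ) < y := hy
    have h1 : y ≤ r * (1 + |y - r|) := by
      nlinarith [le_abs_self (y - r), abs_nonneg (y - r)]
    rw [← mul_assoc]
    refine mul_le_mul_of_nonneg_right ?_ (exp_pos _).le
    calc y ^ (d - 1) ≤ (r * (1 + |y - r|)) ^ (d - 1) := by gcongr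
      _ = r ^ (d - 1) * (1 + |y - r|) ^ (d - 1) := mul_pow ..
      _ ≤ _ := by
        gcongr
        · linarith [abs_nonneg (y - r)]
        · omega
  have hint : IntegrableOn (fun y : ℝ => y ^ (d - 1) * exp (-k * |y - r|)) (Set.Ioi 0) := by
    refine hM'.integrableOn.mono' (by fun_prop) ?_
    filter_upwards [ae_restrict_mem measurableSet_Ioi] with y hy
    have hy' : (0 : ℝ) < y := hy
    rw [Real.norm_of_nonneg (by positivity)]
    exact hb y hy
  refine ⟨(integrable_radial hd fun y => exp (-k * |y - r|)).2 hint, ?_⟩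
  rw [integral_radial hd fun y => exp (-k * |y - r|), mul_assoc]
  refine mul_le_mul_of_nonneg_left ?_ (sphereArea_pos hd).le
  calc ∫ y in Set.Ioi (0 : ℝ), y ^ (d - 1) * exp (-k * |y - r|)
      ≤ ∫ y in Set.Ioi (0 : ℝ),
          r ^ (d - 1) * ((1 + |y - r|) ^ (d + 1) * exp (-k * |y - r|)) :=
        setIntegral_mono_on hint hM'.integrableOn measurableSet_Ioi hb
    _ ≤ ∫ y : ℝ, r ^ (d - 1) * ((1 + |y - r|) ^ (d + 1) * exp (-k * |y - r|)) :=
        setIntegral_le_integral hM' (Eventually.of_forall fun y => by positivity)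
    _ = expMoment d k * r ^ (d - 1) := by
        rw [integral_const_mul, mul_comm,
          integral_sub_right_eq_self (fun y : ℝ => (1 + |y|) ^ (d + 1) * exp (-k * |y|)) r,
          expMoment]

lemma measurableSet_Box (d : ℕ) (L : ℝ) : MeasurableSet (Box d L) := by
  have : Box d L = ⋂ i : Fin d, {x : Ed d | x i ∈ Set.Ioc (-(L / 2)) (L / 2)} := by
    ext; simp [Box]
  rw [this]
  refine MeasurableSet.iInter fun i => ?_
  exact (by fun_prop : Measurable fun x : Ed d => x i) measurableSet_Ioc

lemma volume_Box (d : ℕ) {L : ℝ} (hL : 0 < L) : volume (Box d L) = ENNReal.ofReal (L ^ d) := by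
  have h : Box d L = WithLp.ofLp ⁻¹'
      (Set.univ.pi fun _ : Fin d => Set.Ioc (-(L / 2)) (L / 2)) := by
    ext; simp [Box]
  rw [h, (PiLp.volume_preserving_ofLp (Fin d)).measure_preimage
    (MeasurableSet.univ_pi fun _ => measurableSet_Ioc).nullMeasurableSet, Real.volume_pi_Ioc]
  simp [ENNReal.ofReal_pow hL.le]

lemma ball_subset_Box {d : ℕ} {L ρ : ℝ} (h : ρ ≤ L / 2) :
    Metric.ball (0 : Ed d) ρ ⊆ Box d L := by
  intro x hx i
  have h1 : |x i| ≤ ‖x‖ := PiLp.norm_apply_le x i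
  have h2 : ‖x‖ < ρ := by simpa using hx
  have := abs_le.1 h1
  exact ⟨by linarith, by linarith⟩

/-- Integrals over the box of functions concentrated near the sphere of radius `r` reduce to
one-dimensional integrals, up to an exponentially small error. -/
lemma integral_Box_layer {d : ℕ} (hd : 2 ≤ d) {k : ℝ} (hk : 0 < k) {A L r R : ℝ} (hA : 0 ≤ A)
    (hr : 1 ≤ r) (hRr : R ≤ r) (hL : r + R ≤ L / 2) {f : ℝ → ℝ} (hf : Measurable f)
    (hfb : ∀ s, |f s| ≤ A * exp (-(2 * k) * |s|)) :
    IntegrableOn (fun x : Ed d => f (‖x‖ - r)) (Box d L) ∧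
    |(∫ x in Box d L, f (‖x‖ - r)) -
        sphereArea d * ∫ s in Set.Ioo (-R) R, (r + s) ^ (d - 1) * f s| ≤
      A * (sphereArea d * expMoment d k) * (r ^ (d - 1) * exp (-k * R)) := by
  obtain ⟨hei, hel⟩ := integral_exp_layer hd hk hr
  have hbk : ∀ s, |f s| ≤ A * exp (-k * |s|) := fun s => (hfb s).trans <| by
    gcongr
    nlinarith [abs_nonneg s]
  have hfi : Integrable (fun x : Ed d => f (‖x‖ - r)) :=
    (hei.const_mul A).mono' (hf.comp (by fun_prop)).aestronglyMeasurable
      (Eventually.of_forall fun x => hbk _)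
  have hD : MeasurableSet {x : Ed d | ‖x‖ - r ∈ Set.Ioo (-R) R} :=
    (by fun_prop : Measurable fun x : Ed d => ‖x‖ - r) measurableSet_Ioo
  have hsub : {x : Ed d | ‖x‖ - r ∈ Set.Ioo (-R) R} ⊆ Box d L := fun x hx =>
    ball_subset_Box hL (by simpa using (by linarith [hx.2] : ‖x‖ < r + R))
  have hpol : ∫ x in {x : Ed d | ‖x‖ - r ∈ Set.Ioo (-R) R}, f (‖x‖ - r) =
      sphereArea d * ∫ s in Set.Ioo (-R) R, (r + s) ^ (d - 1) * f s := by
    have e1 : ∫ x in {x : Ed d | ‖x‖ - r ∈ Set.Ioo (-R) R}, f (‖x‖ - r) =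
        ∫ x : Ed d, (Set.Ioo (-R) R).indicator f (‖x‖ - r) := by
      rw [← integral_indicator hD]
      rfl
    rw [e1, integral_radial hd fun y => (Set.Ioo (-R) R).indicator f (y - r)]
    congr 1
    rw [← integral_indicator measurableSet_Ioi, ← integral_indicator measurableSet_Ioo,
      ← integral_sub_right_eq_self
        ((Set.Ioo (-R) R).indicator fun s => (r + s) ^ (d - 1) * f s) r]
    congr 1
    ext y
    by_cases h1 : y - r ∈ Set.Ioo (-R) R
    · have h2 : y ∈ Set.Ioi (0 : ℝ) := by
        have := h1.1
        simp only [Set.mem_Ioi]; linarith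
      simp [Set.indicator_of_mem h1, Set.indicator_of_mem h2]
    · rw [Set.indicator_of_notMem h1]
      by_cases h2 : y ∈ Set.Ioi (0 : ℝ)
      · rw [Set.indicator_of_mem h2, Set.indicator_of_notMem h1, mul_zero]
      · rw [Set.indicator_of_notMem h2]
  refine ⟨hfi.integrableOn, ?_⟩
  rw [← hpol, ← setIntegral_sdiff hD hfi.integrableOn hsub]
  calc |∫ x in Box d L \ {x : Ed d | ‖x‖ - r ∈ Set.Ioo (-R) R}, f (‖x‖ - r)|
      ≤ ∫ x in Box d L \ {x : Ed d | ‖x‖ - r ∈ Set.Ioo (-R) R},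
          A * exp (-k * R) * exp (-k * |‖x‖ - r|) := by
        rw [← Real.norm_eq_abs]
        refine norm_integral_le_of_norm_le (hei.const_mul _).integrableOn ?_
        filter_upwards [ae_restrict_mem ((measurableSet_Box d L).diff hD)] with x hx
        refine (hfb _).trans ?_
        rw [mul_assoc, ← Real.exp_add]
        have : R ≤ |‖x‖ - r| := by
          by_contra! h
          exact hx.2 (abs_lt.1 h)
        gcongr
        nlinarith
    _ ≤ ∫ x : Ed d, A * exp (-k * R) * exp (-k * |‖x‖ - r|) :=
        setIntegral_le_integral (hei.const_mul _) (Eventually.of_forall fun x => by positivity)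
    _ = A * exp (-k * R) * ∫ x : Ed d, exp (-k * |‖x‖ - r|) := integral_const_mul _ _
    _ ≤ A * exp (-k * R) * (sphereArea d * expMoment d k * r ^ (d - 1)) := by gcongr
    _ = _ := by ring

/-- Reflection invariance of integrals over symmetric intervals. -/
lemma setIntegral_Ioo_neg_comp (R : ℝ) (g : ℝ → ℝ) :
    ∫ s in Set.Ioo (-R) R, g (-s) = ∫ s in Set.Ioo (-R) R, g s := by
  rw [← integral_indicator measurableSet_Ioo, ← integral_indicator measurableSet_Ioo,
    ← integral_neg_eq_self ((Set.Ioo (-R) R).indicator g)]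
  congr 1
  ext s
  have : s ∈ Set.Ioo (-R) R ↔ -s ∈ Set.Ioo (-R) R := by
    constructor <;> rintro ⟨h1, h2⟩ <;> constructor <;> linarith
  by_cases h : s ∈ Set.Ioo (-R) R
  · rw [Set.indicator_of_mem h, Set.indicator_of_mem (this.1 h)]
  · rw [Set.indicator_of_notMem h, Set.indicator_of_notMem (mt this.2 h)]

/-- Absolute integral bound for a polynomial weight against an exponentially decaying function. -/
lemma abs_setIntegral_weight_le {d : ℕ} {k A B R : ℝ} (hk : 0 < k) (hB : 0 ≤ B) (hA : 0 ≤ A)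
    {p f : ℝ → ℝ} (hfb : ∀ s, |f s| ≤ A * exp (-k * |s|))
    (hp : ∀ s ∈ Set.Ioo (-R) R, |p s| ≤ B * (1 + |s|) ^ (d + 1)) :
    |∫ s in Set.Ioo (-R) R, p s * f s| ≤ A * expMoment d k * B := by
  have hM := (integrable_one_add_abs_pow_mul_exp (d + 1) hk).const_mul (B * A)
  calc |∫ s in Set.Ioo (-R) R, p s * f s|
      ≤ ∫ s in Set.Ioo (-R) R, B * A * ((1 + |s|) ^ (d + 1) * exp (-k * |s|)) := by
        rw [← Real.norm_eq_abs]
        refine norm_integral_le_of_norm_le hM.integrableOn ?_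
        filter_upwards [ae_restrict_mem measurableSet_Ioo] with s hs
        rw [norm_mul, Real.norm_eq_abs, Real.norm_eq_abs]
        calc |p s| * |f s| ≤ (B * (1 + |s|) ^ (d + 1)) * (A * exp (-k * |s|)) :=
              mul_le_mul (hp s hs) (hfb s) (abs_nonneg _) (by positivity)
          _ = _ := by ring
    _ ≤ ∫ s : ℝ, B * A * ((1 + |s|) ^ (d + 1) * exp (-k * |s|)) :=
        setIntegral_le_integral hM (Eventually.of_forall fun s => by positivity)
    _ = A * expMoment d k * B := by rw [integral_const_mul, expMoment]; ring

lemma abs_add_pow_sub_le {r s : ℝ} (n : ℕ) (hs : |s| ≤ r) (t : ℝ) (ht : |t| ≤ r) :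
    |(r + s) ^ n - (r + t) ^ n| ≤ |s - t| * (n * 2 ^ (n - 1)) * r ^ (n - 1) := by
  have hr : 0 ≤ r := (abs_nonneg s).trans hs
  refine (abs_pow_sub_pow_le ..).trans ?_
  have h1 : max |r + s| |r + t| ≤ 2 * r := by
    refine max_le ((abs_add_le _ _).trans ?_) ((abs_add_le _ _).trans ?_) <;>
    · rw [abs_of_nonneg hr]; linarith
  calc |r + s - (r + t)| * n * max |r + s| |r + t| ^ (n - 1)
      ≤ |r + s - (r + t)| * n * (2 * r) ^ (n - 1) := by gcongr
    _ = _ := by rw [mul_pow, add_sub_add_left_eq_sub]; ring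

/-- Second symmetric difference of a power. -/
lemma exists_symm_diff_pow_bound (n : ℕ) : ∃ c : ℝ, 0 ≤ c ∧ ∀ r s : ℝ, |s| ≤ r →
    |(r + s) ^ n + (r - s) ^ n - 2 * r ^ n| ≤ c * s ^ 2 * r ^ (n - 2) := by
  induction n with
  | zero => exact ⟨0, le_rfl, fun r s _ => by norm_num⟩
  | succ n ih =>
    obtain ⟨c, hc, h⟩ := ih
    rcases Nat.eq_zero_or_pos n with rfl | hn
    · refine ⟨0, le_rfl, fun r s _ => ?_⟩
      ring_nf; simp
    rcases Nat.lt_or_eq_of_le (Nat.succ_le_of_lt hn) with h' | rfl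
    swap
    · refine ⟨2, by norm_num, fun r s _ => le_of_eq ?_⟩
      rw [abs_of_nonneg] <;> ring_nf
      positivity
    refine ⟨c + 2 * (n * 2 ^ (n - 1)), by positivity, fun r s hs => ?_⟩
    have hr : 0 ≤ r := (abs_nonneg s).trans hs
    have h1 := h r s hs
    have h2 := abs_add_pow_sub_le n hs (-s) (by rwa [abs_neg])
    have e : (r + s) ^ (n + 1) + (r - s) ^ (n + 1) - 2 * r ^ (n + 1) =
        r * ((r + s) ^ n + (r - s) ^ n - 2 * r ^ n) + s * ((r + s) ^ n - (r + -s) ^ n) := by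
      ring
    have e2 : |s - -s| = 2 * |s| := by rw [sub_neg_eq_add, ← two_mul, abs_mul]; norm_num
    have e3 : n + 1 - 2 = n - 1 := by omega
    have h3 : r * (c * s ^ 2 * r ^ (n - 2)) ≤ c * s ^ 2 * r ^ (n - 1) := by
      obtain ⟨m, rfl⟩ := Nat.exists_eq_add_of_le' h'
      simp only [Nat.add_sub_cancel, show m + 2 - 1 = m + 1 by omega]
      exact le_of_eq (by ring)
    rw [e, e3]
    refine (abs_add_le _ _).trans ?_
    rw [abs_mul, abs_mul, abs_of_nonneg hr]
    rw [e2] at h2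
    calc r * |(r + s) ^ n + (r - s) ^ n - 2 * r ^ n| + |s| * |(r + s) ^ n - (r + -s) ^ n|
        ≤ r * (c * s ^ 2 * r ^ (n - 2)) +
          |s| * (2 * |s| * (n * 2 ^ (n - 1)) * r ^ (n - 1)) := by gcongr
      _ ≤ c * s ^ 2 * r ^ (n - 1) + |s| * (2 * |s| * (n * 2 ^ (n - 1)) * r ^ (n - 1)) := by
          gcongr
      _ = c * s ^ 2 * r ^ (n - 1) + |s| ^ 2 * (2 * (n * 2 ^ (n - 1))) * r ^ (n - 1) := by ring
      _ = _ := by rw [sq_abs]; ring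

lemma integrable_of_exp_bound {k A : ℝ} (hk : 0 < k) {f : ℝ → ℝ} (hf : Measurable f)
    (hfb : ∀ s, |f s| ≤ A * exp (-k * |s|)) : Integrable f := by
  have h := (integrable_one_add_abs_pow_mul_exp 0 hk).const_mul A
  simp only [pow_zero, one_mul] at h
  exact h.mono' hf.aestronglyMeasurable (Eventually.of_forall hfb)

lemma integrableOn_Ioo_mul {k A R : ℝ} (hk : 0 < k) {p f : ℝ → ℝ} (hp : Continuous p)
    (hf : Measurable f) (hfb : ∀ s, |f s| ≤ A * exp (-k * |s|)) :
    IntegrableOn (fun s => p s * f s) (Set.Ioo (-R) R) :=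
  ((integrable_of_exp_bound hk hf hfb).integrableOn.continuousOn_mul hp.continuousOn
    isCompact_Icc).mono_set Set.Ioo_subset_Icc_self

lemma exp_bound_weaken {k A : ℝ} (hk : 0 < k) (hA : 0 ≤ A) {f : ℝ → ℝ}
    (hfb : ∀ s, |f s| ≤ A * exp (-(2 * k) * |s|)) (s : ℝ) : |f s| ≤ A * exp (-k * |s|) :=
  (hfb s).trans <| by
    gcongr
    nlinarith [abs_nonneg s]

/-- A layer function contributes at most order `r^{d-1}`. -/
lemma exists_layer_bound {d : ℕ} (hd : 2 ≤ d) {k : ℝ} (hk : 0 < k) :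
    ∃ C : ℝ, 0 ≤ C ∧ ∀ A L r R : ℝ, 0 ≤ A → 1 ≤ r → 0 ≤ R → R ≤ r → r + R ≤ L / 2 →
      ∀ f : ℝ → ℝ, Measurable f → (∀ s, |f s| ≤ A * exp (-(2 * k) * |s|)) →
        |∫ x in Box d L, f (‖x‖ - r)| ≤ C * A * r ^ (d - 1) := by
  have hσ := sphereArea_pos hd
  have hM := expMoment_nonneg d k
  refine ⟨sphereArea d * expMoment d k, by positivity,
    fun A L r R hA hr hR0 hR hL f hf hfb => ?_⟩
  obtain ⟨hei, hel⟩ := integral_exp_layer hd hk hr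
  calc |∫ x in Box d L, f (‖x‖ - r)| ≤ ∫ x in Box d L, A * exp (-k * |‖x‖ - r|) := by
        rw [← Real.norm_eq_abs]
        exact norm_integral_le_of_norm_le (hei.const_mul _).integrableOn
          (Eventually.of_forall fun x => exp_bound_weaken hk hA hfb _)
    _ ≤ ∫ x : Ed d, A * exp (-k * |‖x‖ - r|) :=
        setIntegral_le_integral (hei.const_mul _) (Eventually.of_forall fun x => by positivity)
    _ = A * ∫ x : Ed d, exp (-k * |‖x‖ - r|) := integral_const_mul _ _
    _ ≤ A * (sphereArea d * expMoment d k * r ^ (d - 1)) := by gcongr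
    _ = _ := by ring

/-- For an odd layer function the leading order cancels. -/
lemma exists_odd_layer_bound {d : ℕ} (hd : 2 ≤ d) {k : ℝ} (hk : 0 < k) :
    ∃ C : ℝ, 0 ≤ C ∧ ∀ A L r R : ℝ, 0 ≤ A → 1 ≤ r → 0 ≤ R → R ≤ r → r + R ≤ L / 2 →
      ∀ f : ℝ → ℝ, Measurable f → (∀ s, |f s| ≤ A * exp (-(2 * k) * |s|)) →
        (∀ s, f (-s) = -f s) →
        |∫ x in Box d L, f (‖x‖ - r)| ≤
          C * A * (r ^ (d - 2) + r ^ (d - 1) * exp (-k * R)) := by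
  have hσ := sphereArea_pos hd
  have hM := expMoment_nonneg d k
  set c : ℝ := ((d - 1 : ℕ) : ℝ) * 2 ^ (d - 1 - 1) with hc
  have hc0 : 0 ≤ c := by positivity
  refine ⟨sphereArea d * expMoment d k * (1 + c), by positivity,
    fun A L r R hA hr hR0 hR hL f hf hfb hodd => ?_⟩
  obtain ⟨-, h1⟩ := integral_Box_layer hd hk hA hr hR hL hf hfb
  have hb := exp_bound_weaken hk hA hfb
  have hz : ∫ s in Set.Ioo (-R) R, f s = 0 := by
    have := setIntegral_Ioo_neg_comp R f
    simp only [hodd, integral_neg] at this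
    linarith
  have h2 : ∫ s in Set.Ioo (-R) R, (r + s) ^ (d - 1) * f s =
      ∫ s in Set.Ioo (-R) R, ((r + s) ^ (d - 1) - r ^ (d - 1)) * f s := by
    simp only [sub_mul]
    rw [integral_sub (integrableOn_Ioo_mul hk (by fun_prop) hf hb)
      (integrableOn_Ioo_mul hk (by fun_prop) hf hb), integral_const_mul, hz]
    ring
  have h3 : |∫ s in Set.Ioo (-R) R, ((r + s) ^ (d - 1) - r ^ (d - 1)) * f s| ≤
      A * expMoment d k * (c * r ^ (d - 2)) := by
    refine abs_setIntegral_weight_le hk (by positivity) hA hb fun s hs => ?_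
    have hs' : |s| ≤ r := (abs_lt.2 hs).le.trans hR
    have := abs_add_pow_sub_le (d - 1) hs' 0 (by simp; linarith)
    rw [add_zero, sub_zero, ← hc, show d - 1 - 1 = d - 2 by omega] at this
    have h4 : |s| ≤ (1 + |s|) ^ (d + 1) := by
      have := le_self_pow₀ (by linarith [abs_nonneg s] : 1 ≤ 1 + |s|) (by omega : d + 1 ≠ 0)
      linarith
    calc _ ≤ |s| * c * r ^ (d - 2) := this
      _ = c * r ^ (d - 2) * |s| := by ring
      _ ≤ _ := by gcongr
  rw [h2] at h1
  set I := ∫ x in Box d L, f (‖x‖ - r)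
  set J := ∫ s in Set.Ioo (-R) R, ((r + s) ^ (d - 1) - r ^ (d - 1)) * f s
  have h5 : |sphereArea d * J| ≤ sphereArea d * (A * expMoment d k * (c * r ^ (d - 2))) := by
    rw [abs_mul, abs_of_pos hσ]; gcongr
  have h6 : |I| ≤ |I - sphereArea d * J| + |sphereArea d * J| := by
    simpa using abs_add_le (I - sphereArea d * J) (sphereArea d * J)
  set Y := r ^ (d - 1) * exp (-k * R)
  have hY : 0 ≤ Y := by positivity
  have hr2 : 0 ≤ r ^ (d - 2) := by positivity
  have h7 : 0 ≤ A * (sphereArea d * expMoment d k) := by positivity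
  calc |I| ≤ A * (sphereArea d * expMoment d k) * Y +
        sphereArea d * (A * expMoment d k * (c * r ^ (d - 2))) := by linarith
    _ = A * (sphereArea d * expMoment d k) * (Y + c * r ^ (d - 2)) := by ring
    _ ≤ A * (sphereArea d * expMoment d k) * ((1 + c) * (r ^ (d - 2) + Y)) := by
        gcongr
        nlinarith [mul_nonneg hc0 hY]
    _ = _ := by ring

/-- For an even layer function the first-order correction cancels. -/
lemma exists_even_layer_bound {d : ℕ} (hd : 2 ≤ d) {k : ℝ} (hk : 0 < k) :
    ∃ C : ℝ, 0 ≤ C ∧ ∀ A L r R : ℝ, 0 ≤ A → 1 ≤ r → 0 ≤ R → R ≤ r → r + R ≤ L / 2 →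
      ∀ f : ℝ → ℝ, Measurable f → (∀ s, |f s| ≤ A * exp (-(2 * k) * |s|)) →
        (∀ s, f (-s) = f s) →
        |(∫ x in Box d L, f (‖x‖ - r)) -
            sphereArea d * r ^ (d - 1) * ∫ s in Set.Ioo (-R) R, f s| ≤
          C * A * (r ^ (d - 3) + r ^ (d - 1) * exp (-k * R)) := by
  have hσ := sphereArea_pos hd
  have hM := expMoment_nonneg d k
  obtain ⟨c, hc0, hc⟩ := exists_symm_diff_pow_bound (d - 1)
  refine ⟨sphereArea d * expMoment d k * (1 + c), by positivity,
    fun A L r R hA hr hR0 hR hL f hf hfb heven => ?_⟩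
  obtain ⟨-, h1⟩ := integral_Box_layer hd hk hA hr hR hL hf hfb
  have hb := exp_bound_weaken hk hA hfb
  have hn : ∫ s in Set.Ioo (-R) R, (r - s) ^ (d - 1) * f s =
      ∫ s in Set.Ioo (-R) R, (r + s) ^ (d - 1) * f s := by
    have := setIntegral_Ioo_neg_comp R fun s => (r + s) ^ (d - 1) * f s
    simpa only [heven, ← sub_eq_add_neg] using this
  have h2 : ∫ s in Set.Ioo (-R) R,
        ((r + s) ^ (d - 1) + (r - s) ^ (d - 1) - 2 * r ^ (d - 1)) * f s =
      2 * (∫ s in Set.Ioo (-R) R, (r + s) ^ (d - 1) * f s) -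
        2 * (r ^ (d - 1) * ∫ s in Set.Ioo (-R) R, f s) := by
    have i1 : IntegrableOn (fun s => (r + s) ^ (d - 1) * f s) (Set.Ioo (-R) R) :=
      integrableOn_Ioo_mul hk (by fun_prop) hf hb
    have i2 : IntegrableOn (fun s => (r - s) ^ (d - 1) * f s) (Set.Ioo (-R) R) :=
      integrableOn_Ioo_mul hk (by fun_prop) hf hb
    have i3 : IntegrableOn (fun s => 2 * r ^ (d - 1) * f s) (Set.Ioo (-R) R) :=
      integrableOn_Ioo_mul hk (by fun_prop) hf hb
    have i12 : IntegrableOn (fun s => (r + s) ^ (d - 1) * f s + (r - s) ^ (d - 1) * f s)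
      (Set.Ioo (-R) R) := i1.add i2
    simp only [sub_mul, add_mul]
    rw [integral_sub i12 i3, integral_add i1 i2, integral_const_mul, hn]
    ring
  have h3 : |∫ s in Set.Ioo (-R) R,
        ((r + s) ^ (d - 1) + (r - s) ^ (d - 1) - 2 * r ^ (d - 1)) * f s| ≤
      A * expMoment d k * (c * r ^ (d - 3)) := by
    refine abs_setIntegral_weight_le hk (by positivity) hA hb fun s hs => ?_
    have hs' : |s| ≤ r := (abs_lt.2 hs).le.trans hR
    have := hc r s hs'
    rw [show d - 1 - 2 = d - 3 by omega] at this
    have h4 : s ^ 2 ≤ (1 + |s|) ^ (d + 1) := by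
      calc s ^ 2 = |s| ^ 2 := (sq_abs s).symm
        _ ≤ (1 + |s|) ^ 2 := by gcongr; linarith
        _ ≤ _ := pow_le_pow_right₀ (by linarith [abs_nonneg s]) (by omega)
    calc _ ≤ c * s ^ 2 * r ^ (d - 3) := this
      _ = c * r ^ (d - 3) * s ^ 2 := by ring
      _ ≤ _ := by gcongr
  rw [h2] at h3
  set I := ∫ x in Box d L, f (‖x‖ - r)
  set J := ∫ s in Set.Ioo (-R) R, (r + s) ^ (d - 1) * f s
  set F := ∫ s in Set.Ioo (-R) R, f s
  set Y := r ^ (d - 1) * exp (-k * R)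
  have hY : 0 ≤ Y := by positivity
  have hr2 : 0 ≤ r ^ (d - 3) := by positivity
  have h5 : |sphereArea d * (2 * J - 2 * (r ^ (d - 1) * F))| ≤
      sphereArea d * (A * expMoment d k * (c * r ^ (d - 3))) := by
    rw [abs_mul, abs_of_pos hσ]; gcongr
  have h6 : |I - sphereArea d * r ^ (d - 1) * F| ≤ |I - sphereArea d * J| +
      |sphereArea d * (2 * J - 2 * (r ^ (d - 1) * F))| := by
    have e : I - sphereArea d * r ^ (d - 1) * F = (I - sphereArea d * J) +
      sphereArea d * (2 * J - 2 * (r ^ (d - 1) * F)) / 2 := by ring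
    rw [e]
    refine (abs_add_le _ _).trans ?_
    rw [abs_div, abs_two]
    linarith [abs_nonneg (sphereArea d * (2 * J - 2 * (r ^ (d - 1) * F)))]
  have h7 : 0 ≤ A * (sphereArea d * expMoment d k) := by positivity
  calc _ ≤ A * (sphereArea d * expMoment d k) * Y +
        sphereArea d * (A * expMoment d k * (c * r ^ (d - 3))) := by linarith
    _ = A * (sphereArea d * expMoment d k) * (Y + c * r ^ (d - 3)) := by ring
    _ ≤ A * (sphereArea d * expMoment d k) * ((1 + c) * (r ^ (d - 3) + Y)) := by
        gcongr
        nlinarith [mul_nonneg hc0 hY]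
    _ = _ := by ring

lemma hasDerivAt_tanh_real (x : ℝ) : HasDerivAt Real.tanh (1 - Real.tanh x ^ 2) x := by
  have h := (Real.hasDerivAt_sinh x).div (Real.hasDerivAt_cosh x) (Real.cosh_pos x).ne'
  have e : Real.tanh = Real.sinh / Real.cosh := by
    ext y; exact Real.tanh_eq_sinh_div_cosh y
  rw [e]
  refine h.congr_deriv ?_
  have := (Real.cosh_pos x).ne'
  simp only [Pi.div_apply]
  field_simp

lemma hasDerivAt_tanh_div_sqrt_two (s : ℝ) :
    HasDerivAt (fun s => Real.tanh (s / √2)) ((1 - Real.tanh (s / √2) ^ 2) * (1 / √2)) s :=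
  HasDerivAt.comp (h := fun s : ℝ => s / √2) s (hasDerivAt_tanh_real (s / √2))
    ((hasDerivAt_id' s).div_const √2)

lemma one_sub_tanh_le (y : ℝ) : 1 - Real.tanh y ≤ 2 * exp (-(2 * y)) := by
  rw [Real.tanh_eq, one_sub_div (by positivity), div_le_iff₀ (by positivity)]
  have h1 : exp (-(2 * y)) * exp y = exp (-y) := by rw [← Real.exp_add]; ring_nf
  have h2 : 0 < exp (-(2 * y)) * exp (-y) := by positivity
  nlinarith

lemma tanh_nonneg_of_nonneg {y : ℝ} (hy : 0 ≤ y) : 0 ≤ Real.tanh y := by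
  rw [Real.tanh_eq_sinh_div_cosh]
  exact div_nonneg (Real.sinh_nonneg_iff.2 hy) (Real.cosh_pos y).le

lemma measurable_sign_real : Measurable Real.sign := by
  unfold Real.sign
  exact Measurable.ite measurableSet_Iio measurable_const
    (Measurable.ite measurableSet_Ioi measurable_const measurable_const)

section Profile

variable {K R : ℝ} {w : ℝ → ℝ}

lemma IsProfile.zero (h : IsProfile K R w) : w 0 = 0 := by
  have := h.2.1 0
  rw [neg_zero] at this
  linarith

lemma IsProfile.abs_add_sign_le (h : IsProfile K R w) (hK : 1 ≤ K) (t : ℝ) :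
    |w t + Real.sign t| ≤ 2 * K * exp (-|t| / K) := by
  have hpos : ∀ t : ℝ, 0 < t → |w t + Real.sign t| ≤ 2 * K * exp (-|t| / K) := by
    intro t ht
    rcases lt_or_ge |t| R with hR | hR
    · rw [h.2.2.2.2.1 t hR, Real.sign_of_pos ht, vprof, neg_add_eq_sub,
        abs_of_pos (by linarith [Real.tanh_lt_one (t / √2)]), abs_of_pos ht]
      refine (one_sub_tanh_le _).trans ?_
      have h1 : -(2 * (t / √2)) ≤ -t / K := by
        have e : 2 * (t / √2) = √2 * t := by
          rw [← mul_div_assoc, div_eq_iff (by positivity)]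
          nlinarith [Real.mul_self_sqrt (by norm_num : (0 : ℝ) ≤ 2)]
        rw [e, neg_div, neg_le_neg_iff, div_le_iff₀ (by linarith)]
        have : 1 ≤ √2 := Real.one_le_sqrt.2 (by norm_num)
        nlinarith [mul_nonneg (mul_nonneg ht.le (sub_nonneg.2 this)) (by linarith : 0 ≤ K),
          mul_nonneg ht.le (sub_nonneg.2 hK)]
      gcongr
      linarith
    · refine (h.2.2.2.2.2.2.1 t hR).trans ?_
      gcongr
      linarith
  rcases lt_trichotomy t 0 with ht | rfl | ht
  · have := hpos (-t) (by linarith)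
    rwa [h.2.1, Real.sign_neg, ← neg_add, abs_neg, abs_neg] at this
  · rw [h.zero, Real.sign_zero]
    simp only [add_zero, abs_zero]
    positivity
  · exact hpos t ht

lemma IsProfile.one_sub_sq_nonneg (h : IsProfile K R w) (t : ℝ) : 0 ≤ 1 - w t ^ 2 := by
  have := sq_le_one_iff_abs_le_one _ |>.2 (h.2.2.2.1 t)
  linarith

lemma IsProfile.one_sub_sq_le (h : IsProfile K R w) (hK : 1 ≤ K) (t : ℝ) :
    1 - w t ^ 2 ≤ 4 * K * exp (-|t| / K) := by
  rcases eq_or_ne t 0 with rfl | ht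
  · simp only [h.zero, abs_zero, neg_zero, zero_div, exp_zero]
    linarith
  · have h1 := h.abs_add_sign_le hK t
    have h2 := h.2.2.2.1 t
    have h3 : 1 - |w t| ≤ |w t + Real.sign t| := by
      have : |Real.sign t| = 1 := by
        rcases ht.lt_or_gt with h | h
        · simp [Real.sign_of_neg h]
        · simp [Real.sign_of_pos h]
      have h4 := abs_sub_abs_le_abs_sub (Real.sign t) (-w t)
      rw [this, abs_neg, sub_neg_eq_add, add_comm (Real.sign t)] at h4
      exact h4
    rw [← sq_abs]
    nlinarith [abs_nonneg (w t)]

lemma IsProfile.deriv_neg (h : IsProfile K R w) (t : ℝ) : deriv w (-t) = deriv w t := by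
  have e : (fun x => w (-x)) = fun x => -w x := funext h.2.1
  have h1 : deriv (fun x => w (-x)) t = -deriv w (-t) := deriv_comp_neg w t
  rw [e] at h1
  have h2 : deriv (fun x => -w x) t = -deriv w t := deriv.fun_neg
  linarith

lemma IsProfile.energy_density_eq (h : IsProfile K R w) {s : ℝ} (hs : s ∈ Set.Ioo (-R) R) :
    deriv w s ^ 2 / 2 + Gpot (w s) = (1 - Real.tanh (s / √2) ^ 2) ^ 2 / 2 := by
  have e : w =ᶠ[𝓝 s] vprof := by
    filter_upwards [isOpen_Ioo.mem_nhds hs] with t ht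
    exact h.2.2.2.2.1 t (abs_lt.2 ht)
  have hd : HasDerivAt vprof (-((1 - Real.tanh (s / √2) ^ 2) * (1 / √2))) s :=
    (hasDerivAt_tanh_div_sqrt_two s).neg
  rw [e.deriv_eq, hd.deriv, e.eq_of_nhds, Gpot, vprof, neg_sq, neg_sq, mul_pow, div_pow,
    Real.sq_sqrt (by norm_num)]
  ring

/-- The one-dimensional energy of the profile is `c₀` up to an exponentially small error. -/
lemma IsProfile.energy_core (h : IsProfile K R w) (hR : 0 ≤ R) :
    |(∫ s in Set.Ioo (-R) R, (deriv w s ^ 2 / 2 + Gpot (w s))) - c₀| ≤ 4 * exp (-R) := by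
  have e : ∫ s in Set.Ioo (-R) R, (deriv w s ^ 2 / 2 + Gpot (w s)) =
      ∫ s in (-R)..R, (1 - Real.tanh (s / √2) ^ 2) ^ 2 / 2 := by
    rw [intervalIntegral.integral_of_le (by linarith), integral_Ioc_eq_integral_Ioo]
    exact setIntegral_congr_fun measurableSet_Ioo fun s hs => h.energy_density_eq hs
  have hcont : Continuous Real.tanh :=
    continuous_iff_continuousAt.2 fun x => (hasDerivAt_tanh_real x).continuousAt
  have hd : ∀ s ∈ Set.uIcc (-R) R, HasDerivAt
      (fun s => √2 / 2 * (Real.tanh (s / √2) - Real.tanh (s / √2) ^ 3 / 3))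
      ((1 - Real.tanh (s / √2) ^ 2) ^ 2 / 2) s := by
    intro s _
    have h1 := hasDerivAt_tanh_div_sqrt_two s
    refine ((h1.sub ((h1.pow 3).div_const 3)).const_mul (√2 / 2)).congr_deriv ?_
    have : √2 ≠ 0 := by positivity
    field_simp
    ring
  rw [e, intervalIntegral.integral_eq_sub_of_hasDerivAt hd
    (by apply Continuous.intervalIntegrable; fun_prop), neg_div, Real.tanh_neg, c₀]
  have h0 := tanh_nonneg_of_nonneg (by positivity : 0 ≤ R / √2)
  have h1 := Real.tanh_lt_one (R / √2)
  have h2 := one_sub_tanh_le (R / √2)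
  set T := Real.tanh (R / √2)
  have h3 : exp (-(2 * (R / √2))) ≤ exp (-R) := by
    apply Real.exp_le_exp.2
    rw [neg_le_neg_iff, ← mul_div_assoc, le_div_iff₀ (by positivity)]
    have : √2 ≤ 2 := Real.sqrt_le_iff.2 (by norm_num)
    nlinarith
  have e1 : √2 / 2 * (T - T ^ 3 / 3) - √2 / 2 * (-T - (-T) ^ 3 / 3) - 2 * √2 / 3 =
      -(√2 * ((1 - T) ^ 2 * (2 + T) / 3)) := by ring
  rw [e1, abs_neg, abs_of_nonneg (by positivity)]
  have h4 : (1 - T) ^ 2 * (2 + T) / 3 ≤ 1 - T := by nlinarith [mul_nonneg h0 (sub_nonneg.2 h1.le)]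
  have h5 : √2 ≤ 2 := Real.sqrt_le_iff.2 (by norm_num)
  calc √2 * ((1 - T) ^ 2 * (2 + T) / 3) ≤ 2 * (1 - T) := by
        apply mul_le_mul h5 h4 (by positivity) (by norm_num)
    _ ≤ 4 * exp (-R) := by linarith

end Profile

lemma volume_real_Box (d : ℕ) {L : ℝ} (hL : 0 < L) : volume.real (Box d L) = L ^ d := by
  rw [Measure.real, volume_Box d hL, ENNReal.toReal_ofReal (by positivity)]

lemma integrableOn_Box_const (d : ℕ) {L : ℝ} (hL : 0 < L) (c : ℝ) :
    IntegrableOn (fun _ : Ed d => c) (Box d L) :=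
  integrableOn_const (by rw [volume_Box d hL]; exact ENNReal.ofReal_ne_top)

lemma setIntegral_Box_const (d : ℕ) {L : ℝ} (hL : 0 < L) (c : ℝ) :
    ∫ _ in Box d L, c = c * L ^ d := by
  rw [setIntegral_const, volume_real_Box d hL, smul_eq_mul, mul_comm]

/-- The mean of the sharp-interface droplet. -/
lemma setIntegral_Box_sign {d : ℕ} (hd : 2 ≤ d) {L r : ℝ} (hL : 0 < L) (hr : 0 < r)
    (hrL : r ≤ L / 2) :
    IntegrableOn (fun x : Ed d => Real.sign (‖x‖ - r)) (Box d L) ∧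
      ∫ x in Box d L, Real.sign (‖x‖ - r) = L ^ d - 2 * (sphereArea d / d * r ^ d) := by
  have := nontrivial_Ed hd
  have hd0 : (d : ℝ) ≠ 0 := by exact_mod_cast (by omega : d ≠ 0)
  have hae : (fun x : Ed d => Real.sign (‖x‖ - r)) =ᵐ[volume]
      fun x => 1 - 2 * (Metric.ball (0 : Ed d) r).indicator (fun _ => 1) x := by
    have hs : volume (Metric.sphere (0 : Ed d) r) = 0 :=
      Measure.addHaar_sphere_of_ne_zero _ _ hr.ne'
    filter_upwards [measure_eq_zero_iff_ae_notMem.1 hs] with x hx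
    have hx' : ‖x‖ ≠ r := by simpa using hx
    rcases lt_or_gt_of_ne hx' with h | h
    · rw [Real.sign_of_neg (by linarith), Set.indicator_of_mem (by simpa using h)]
      norm_num
    · rw [Real.sign_of_pos (by linarith), Set.indicator_of_notMem (by simpa using h.le)]
      norm_num
  have hb : IntegrableOn ((Metric.ball (0 : Ed d) r).indicator fun _ => (1 : ℝ)) (Box d L) :=
    (integrableOn_Box_const d hL 1).integrable.indicator Metric.isOpen_ball.measurableSet
  have hc := integrableOn_Box_const d hL 1
  have hvol : volume.real (Metric.ball (0 : Ed d) r) = sphereArea d / d * r ^ d := by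
    rw [Measure.real, Measure.addHaar_ball _ _ hr.le, ENNReal.toReal_mul,
      ENNReal.toReal_ofReal (by positivity), sphereArea, finrank_euclideanSpace_fin]
    field_simp
  replace hae : (fun x : Ed d => Real.sign (‖x‖ - r)) =ᵐ[volume.restrict (Box d L)]
      fun x => 1 - 2 * (Metric.ball (0 : Ed d) r).indicator (fun _ => 1) x :=
    ae_restrict_of_ae hae
  refine ⟨(hc.sub (hb.const_mul 2)).congr hae.symm, ?_⟩
  rw [integral_congr_ae hae, integral_sub hc (hb.const_mul 2),
    integral_const_mul, setIntegral_indicator Metric.isOpen_ball.measurableSet,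
    Set.inter_eq_right.2 (ball_subset_Box hrL), setIntegral_Box_const d hL,
    setIntegral_const, hvol]
  simp

lemma norm_gradient_radial {d : ℕ} (hd : 2 ≤ d) {w : ℝ → ℝ} (hw : Differentiable ℝ w) (r α : ℝ)
    {x : Ed d} (hx : x ≠ 0) :
    ‖gradient (fun x : Ed d => w (‖x‖ - r) + α) x‖ ^ 2 = deriv w (‖x‖ - r) ^ 2 := by
  have := nontrivial_Ed hd
  have hn : DifferentiableAt ℝ (fun x : Ed d => ‖x‖) x :=
    (differentiableAt_id).norm ℝ hx
  have h1 : HasFDerivAt (fun x : Ed d => w (‖x‖ - r) + α)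
      (deriv w (‖x‖ - r) • fderiv ℝ (fun x : Ed d => ‖x‖) x) x := by
    have := (hw (‖x‖ - r)).hasDerivAt.comp_hasFDerivAt x (hn.hasFDerivAt.sub_const r)
    exact this.add_const α
  rw [gradient, LinearIsometryEquiv.norm_map, h1.fderiv, norm_smul, norm_fderiv_norm hn,
    mul_one, Real.norm_eq_abs, sq_abs]

/-- Taylor expansion of the energy around `w`. -/
lemma CHenergy_expand {d : ℕ} (hd : 2 ≤ d) {w : ℝ → ℝ} (hw : Differentiable ℝ w)
    {L r : ℝ} (hL : 0 < L) (α : ℝ)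
    (h1 : IntegrableOn (fun x : Ed d => w (‖x‖ - r) ^ 3 - w (‖x‖ - r)) (Box d L))
    (h2 : IntegrableOn (fun x : Ed d => 1 - w (‖x‖ - r) ^ 2) (Box d L))
    (h3 : IntegrableOn (fun x : Ed d => deriv w (‖x‖ - r) ^ 2 / 2 + Gpot (w (‖x‖ - r)))
      (Box d L))
    (h4 : IntegrableOn (fun x : Ed d => w (‖x‖ - r)) (Box d L)) :
    CHenergy d L (fun x => w (‖x‖ - r) + α) =
      (∫ x in Box d L, (deriv w (‖x‖ - r) ^ 2 / 2 + Gpot (w (‖x‖ - r)))) +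
      α * (∫ x in Box d L, (w (‖x‖ - r) ^ 3 - w (‖x‖ - r))) +
      (α ^ 2 + α ^ 4 / 4) * L ^ d -
      3 / 2 * α ^ 2 * (∫ x in Box d L, (1 - w (‖x‖ - r) ^ 2)) +
      α ^ 3 * ∫ x in Box d L, w (‖x‖ - r) := by
  have := nontrivial_Ed hd
  have hae : ∀ᵐ x : Ed d ∂volume.restrict (Box d L),
      ‖gradient (fun x : Ed d => w (‖x‖ - r) + α) x‖ ^ 2 / 2 + Gpot (w (‖x‖ - r) + α) =
      (deriv w (‖x‖ - r) ^ 2 / 2 + Gpot (w (‖x‖ - r))) +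
      α * (w (‖x‖ - r) ^ 3 - w (‖x‖ - r)) + (α ^ 2 + α ^ 4 / 4) -
      3 / 2 * α ^ 2 * (1 - w (‖x‖ - r) ^ 2) + α ^ 3 * w (‖x‖ - r) := by
    refine ae_restrict_of_ae ?_
    have h0 : volume ({0} : Set (Ed d)) = 0 := measure_singleton 0
    filter_upwards [measure_eq_zero_iff_ae_notMem.1 h0] with x hx
    rw [norm_gradient_radial hd hw r α (by simpa using hx)]
    simp only [Gpot]
    ring
  have i2 : IntegrableOn (fun x : Ed d => (deriv w (‖x‖ - r) ^ 2 / 2 + Gpot (w (‖x‖ - r))) +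
      α * (w (‖x‖ - r) ^ 3 - w (‖x‖ - r))) (Box d L) := h3.add (h1.const_mul α)
  have i3 : IntegrableOn (fun x : Ed d => (deriv w (‖x‖ - r) ^ 2 / 2 + Gpot (w (‖x‖ - r))) +
      α * (w (‖x‖ - r) ^ 3 - w (‖x‖ - r)) + (α ^ 2 + α ^ 4 / 4)) (Box d L) :=
    i2.add (integrableOn_Box_const d hL _)
  have i4 : IntegrableOn (fun x : Ed d => (deriv w (‖x‖ - r) ^ 2 / 2 + Gpot (w (‖x‖ - r))) +
      α * (w (‖x‖ - r) ^ 3 - w (‖x‖ - r)) + (α ^ 2 + α ^ 4 / 4) -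
      3 / 2 * α ^ 2 * (1 - w (‖x‖ - r) ^ 2)) (Box d L) := i3.sub (h2.const_mul _)
  rw [CHenergy, integral_congr_ae hae, integral_add i4 (h4.const_mul _),
    integral_sub i3 (h2.const_mul _), integral_add i2 (integrableOn_Box_const d hL _),
    integral_add h3 (h1.const_mul α), setIntegral_Box_const d hL, integral_const_mul,
    integral_const_mul, integral_const_mul]

/-- The quadratic remainder coefficient in the expansion is bounded. -/
lemma quadratic_remainder_bound {c a t δ : ℝ} (hc : 0 ≤ c) (ha0 : 0 ≤ a) (ha1 : a ≤ 1)
    (ht0 : 0 ≤ t) (ht1 : t ≤ 1) (hδD : |δ| ≤ 2 * c) :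
    |1 - (3 * a + δ) * (1 - t) - (3 * a ^ 2 + 3 * a * δ + δ ^ 2) +
      (6 * a ^ 2 + 4 * a * δ + δ ^ 2) / 4| ≤ 12 + 12 * c + 8 * c ^ 2 := by
  have hd0 := abs_nonneg δ
  have e3 : 1 - (3 * a + δ) * (1 - t) - (3 * a ^ 2 + 3 * a * δ + δ ^ 2) +
    (6 * a ^ 2 + 4 * a * δ + δ ^ 2) / 4 = (1 - 3 * a * (1 - t) - 3 / 2 * a ^ 2) -
      δ * (1 - t) - 2 * (a * δ) - 3 / 4 * δ ^ 2 := by ring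
  have f1 := abs_le.1 hδD
  have f2 : |δ * (1 - t)| ≤ 2 * c := by
    rw [abs_mul, abs_of_nonneg (sub_nonneg.2 ht1)]; nlinarith
  have f3 : |a * δ| ≤ 2 * c := by
    rw [abs_mul, abs_of_nonneg ha0]; nlinarith
  have f4 : δ ^ 2 ≤ 4 * c ^ 2 := by
    rw [← sq_abs]; nlinarith
  have f5 : a * (1 - t) ≤ 1 := by nlinarith
  have f6 : 0 ≤ a * (1 - t) := mul_nonneg ha0 (sub_nonneg.2 ht1)
  have f7 : a ^ 2 ≤ 1 := by nlinarith
  have f2' := abs_le.1 f2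
  have f3' := abs_le.1 f3
  rw [e3, abs_le]
  constructor <;> linarith [sq_nonneg δ, sq_nonneg a, sq_nonneg c]

set_option maxHeartbeats 1000000 in
/-- The algebraic heart of the expansion: `α = a + δ` with `a = φ (1 - η)` and small `δ`. -/
lemma expansion_algebra {c c1 c2 c3 a t δ V X p1 p2 p3 I1 I2 D3 : ℝ}
    (hc : 0 ≤ c) (hc1 : 0 ≤ c1) (hc2 : 0 ≤ c2) (hc3 : 0 ≤ c3)
    (ha0 : 0 ≤ a) (ha1 : a ≤ 1) (ht0 : 0 ≤ t) (ht1 : t ≤ 1) (hV : 0 < V) (hX : 0 ≤ X)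
    (hp1 : 0 ≤ p1) (hp2 : 0 ≤ p2) (hp3 : 0 ≤ p3) (hp1V : p1 ≤ V) (hp2V : p2 ≤ V) (hXV : X ≤ V)
    (hpp : p2 ^ 2 ≤ V * p3) (hδ : |δ| * V ≤ c * (p2 + X)) (hI1 : |I1| ≤ c1 * (p2 + X))
    (hI2 : |I2| ≤ c2 * p1) (hD3 : |D3| ≤ c3 * (p3 + X)) :
    |D3 + (a + δ) * I1 - 3 / 2 * (a + δ) ^ 2 * I2 +
      V * (((a + δ) ^ 2 - a ^ 2) - ((a + δ) ^ 3 - a ^ 3) + (a + δ) ^ 3 * (t - δ) +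
        ((a + δ) ^ 4 - a ^ 4) / 4)| ≤
      (c3 + c1 * (1 + 2 * c) + 3 * c2 * (1 + 2 * c ^ 2) + 2 * c +
        (12 + 12 * c + 8 * c ^ 2) * (2 * c ^ 2) + 1) *
        (X + a * p2 + a ^ 2 * p1 + V * t * a ^ 3 + p3) := by
  set S := X + a * p2 + a ^ 2 * p1 + V * t * a ^ 3 + p3 with hS
  have q1 : 0 ≤ a * p2 := by positivity
  have q2 : 0 ≤ a ^ 2 * p1 := by positivity
  have q3 : 0 ≤ V * t * a ^ 3 := by positivity
  have hS0 : 0 ≤ S := by positivity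
  have hpX : p3 + X ≤ S := by linarith
  have hY2 : (p2 + X) ^ 2 ≤ 2 * V * (p3 + X) := by
    nlinarith [sq_nonneg (p2 - X), mul_le_mul_of_nonneg_left hXV hX]
  have hd0 := abs_nonneg δ
  have hδD : |δ| ≤ 2 * c := by
    refine le_of_mul_le_mul_right (hδ.trans ?_) hV
    nlinarith
  have hδ2 : δ ^ 2 * V ≤ 2 * c ^ 2 * S := by
    refine le_of_mul_le_mul_right ?_ hV
    calc δ ^ 2 * V * V = (|δ| * V) ^ 2 := by rw [mul_pow, sq_abs]; ring
      _ ≤ (c * (p2 + X)) ^ 2 := by gcongr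
      _ = c ^ 2 * (p2 + X) ^ 2 := by ring
      _ ≤ c ^ 2 * (2 * V * (p3 + X)) := by gcongr
      _ ≤ c ^ 2 * (2 * V * S) := by gcongr
      _ = _ := by ring
  have haY : a * (p2 + X) ≤ S := by
    linarith [mul_le_of_le_one_left hX ha1]
  have haδ : a * |δ| * V ≤ c * S := by
    calc a * |δ| * V = a * (|δ| * V) := by ring
      _ ≤ a * (c * (p2 + X)) := by gcongr
      _ = c * (a * (p2 + X)) := by ring
      _ ≤ c * S := by gcongr
  have hδY : |δ| * (p2 + X) ≤ 2 * c * S := by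
    refine le_of_mul_le_mul_right ?_ hV
    calc |δ| * (p2 + X) * V = |δ| * V * (p2 + X) := by ring
      _ ≤ c * (p2 + X) * (p2 + X) := by gcongr
      _ = c * (p2 + X) ^ 2 := by ring
      _ ≤ c * (2 * V * (p3 + X)) := by gcongr
      _ ≤ c * (2 * V * S) := by gcongr
      _ = _ := by ring
  have b1 : |(a + δ) * I1| ≤ c1 * (1 + 2 * c) * S := by
    calc |(a + δ) * I1| = |a + δ| * |I1| := abs_mul ..
      _ ≤ (a + |δ|) * (c1 * (p2 + X)) := by
        gcongr
        exact (abs_add_le _ _).trans (by rw [abs_of_nonneg ha0])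
      _ = c1 * (a * (p2 + X) + |δ| * (p2 + X)) := by ring
      _ ≤ c1 * (S + 2 * c * S) := by gcongr
      _ = _ := by ring
  have b2 : |3 / 2 * (a + δ) ^ 2 * I2| ≤ 3 * c2 * (1 + 2 * c ^ 2) * S := by
    have e1 : (a + δ) ^ 2 ≤ 2 * (a ^ 2 + δ ^ 2) := by nlinarith [sq_nonneg (a - δ)]
    have e2 : δ ^ 2 * p1 ≤ 2 * c ^ 2 * S :=
      (mul_le_mul_of_nonneg_left hp1V (sq_nonneg δ)).trans hδ2
    calc |3 / 2 * (a + δ) ^ 2 * I2| = 3 / 2 * (a + δ) ^ 2 * |I2| := by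
          rw [abs_mul, abs_of_nonneg (by positivity)]
      _ ≤ 3 / 2 * (2 * (a ^ 2 + δ ^ 2)) * (c2 * p1) := by gcongr
      _ = 3 * c2 * (a ^ 2 * p1 + δ ^ 2 * p1) := by ring
      _ ≤ 3 * c2 * (S + 2 * c ^ 2 * S) := by
        gcongr
        linarith
      _ = _ := by ring
  have e : ((a + δ) ^ 2 - a ^ 2) - ((a + δ) ^ 3 - a ^ 3) + (a + δ) ^ 3 * (t - δ) +
        ((a + δ) ^ 4 - a ^ 4) / 4 = a * δ * (2 - 3 * a * (1 - t)) +
      δ ^ 2 * (1 - (3 * a + δ) * (1 - t) - (3 * a ^ 2 + 3 * a * δ + δ ^ 2) +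
        (6 * a ^ 2 + 4 * a * δ + δ ^ 2) / 4) + t * a ^ 3 := by ring
  have g1 : |2 - 3 * a * (1 - t)| ≤ 2 := by
    have f5 : a * (1 - t) ≤ 1 := mul_le_one₀ ha1 (by linarith) (by linarith)
    have f6 : 0 ≤ a * (1 - t) := mul_nonneg ha0 (by linarith)
    rw [abs_le]
    constructor <;> linarith
  have g2 := quadratic_remainder_bound hc ha0 ha1 ht0 ht1 hδD
  have b3 : |V * (((a + δ) ^ 2 - a ^ 2) - ((a + δ) ^ 3 - a ^ 3) + (a + δ) ^ 3 * (t - δ) +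
        ((a + δ) ^ 4 - a ^ 4) / 4)| ≤
      2 * c * S + (12 + 12 * c + 8 * c ^ 2) * (2 * c ^ 2) * S + S := by
    rw [e]
    set G1 := 2 - 3 * a * (1 - t)
    set G2 := 1 - (3 * a + δ) * (1 - t) - (3 * a ^ 2 + 3 * a * δ + δ ^ 2) +
      (6 * a ^ 2 + 4 * a * δ + δ ^ 2) / 4
    have k1 : |V * (a * δ * G1)| ≤ 2 * c * S := by
      rw [abs_mul, abs_mul, abs_mul, abs_of_pos hV, abs_of_nonneg ha0]
      calc V * (a * |δ| * |G1|) = a * |δ| * V * |G1| := by ring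
        _ ≤ c * S * 2 := by gcongr
        _ = _ := by ring
    have k2 : |V * (δ ^ 2 * G2)| ≤ (12 + 12 * c + 8 * c ^ 2) * (2 * c ^ 2) * S := by
      rw [abs_mul, abs_mul, abs_of_pos hV, abs_of_nonneg (sq_nonneg δ)]
      calc V * (δ ^ 2 * |G2|) = δ ^ 2 * V * |G2| := by ring
        _ ≤ 2 * c ^ 2 * S * (12 + 12 * c + 8 * c ^ 2) := by gcongr
        _ = _ := by ring
    have k3 : |V * (t * a ^ 3)| ≤ S := by
      rw [abs_of_nonneg (by positivity)]
      linarith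
    calc |V * (a * δ * G1 + δ ^ 2 * G2 + t * a ^ 3)|
        = |V * (a * δ * G1) + V * (δ ^ 2 * G2) + V * (t * a ^ 3)| := by ring_nf
      _ ≤ _ := (abs_add_three _ _ _).trans (by linarith)
  have b0 : |D3| ≤ c3 * S := hD3.trans (by gcongr)
  refine (abs_add_le _ _).trans ((add_le_add_left ((abs_sub _ _).trans
    (add_le_add_left (abs_add_le _ _) _)) _).trans ?_)
  linarith

set_option maxHeartbeats 1000000 in
/-- **Energy expansion for the fractional droplet state.** There are constants
`C = C(d,K) < ∞`, `R₀ = R₀(d,K) < ∞` and `M₀ = M₀(d,K) < ∞` such that, whenever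
`r₊ = (φd/(2σ_d))^{1/d} L ≤ L/4`, `R ≥ R₀`, `η ∈ [0,1]` with `r_η ≥ R` and
`1 - η ≥ M₀ φ²`, and `u_η(x) = v_R(|x| - r_η) + α(η)` with `α(η)` chosen so that
`⨍_Ω u_η = -1 + φ`, then
`|E(u_η) - [c₀ σ_d r_η^{d-1} + φ² L^d (1-η)² - φ³ L^d (1-η)³ + (φ⁴ L^d/4)(1-η)⁴]|
  ≤ C (r_η^{d-1} e^{-R/C} + φ(1-η) r_η^{d-2} + φ²(1-η)² r_η^{d-1}
       + φ⁴ η (1-η)³ L^d + r_η^{d-3})`. -/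
theorem droplet_energy_expansion (d : ℕ) (hd : 2 ≤ d) (K : ℝ) (hK : 1 ≤ K) :
    ∃ C : ℝ, 0 < C ∧ ∃ R₀ M₀ : ℝ,
      ∀ L φ : ℝ, 0 < L → 0 < φ → φ < 1 →
        ∀ rplus : ℝ, rplus = (φ * (d : ℝ) / (2 * sphereArea d)) ^ ((1 : ℝ) / d) * L →
          rplus ≤ L / 4 →
          ∀ R : ℝ, R₀ ≤ R → ∀ w : ℝ → ℝ, IsProfile K R w →
            ∀ η ∈ Set.Icc (0 : ℝ) 1,
              ∀ rη : ℝ,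
                rη = η ^ ((1 : ℝ) / d) * (φ * (d : ℝ) / (2 * sphereArea d)) ^ ((1 : ℝ) / d) * L →
                R ≤ rη → M₀ * φ ^ 2 ≤ 1 - η →
                ∀ α : ℝ, (∫ x in Box d L, (w (‖x‖ - rη) + α)) = (-1 + φ) * L ^ d →
                |CHenergy d L (fun x => w (‖x‖ - rη) + α) -
                    (c₀ * sphereArea d * rη ^ (d - 1) + φ ^ 2 * L ^ d * (1 - η) ^ 2 -
                      φ ^ 3 * L ^ d * (1 - η) ^ 3 + φ ^ 4 * L ^ d / 4 * (1 - η) ^ 4)| ≤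
                  C * (rη ^ (d - 1) * Real.exp (-R / C) + φ * (1 - η) * rη ^ (d - 2) +
                    φ ^ 2 * (1 - η) ^ 2 * rη ^ (d - 1) + φ ^ 4 * η * (1 - η) ^ 3 * L ^ d +
                    rη ^ (d - 3)) := by
  set k : ℝ := 1 / (2 * K) with hkdef
  have hK0 : 0 < K := by linarith
  have hk : 0 < k := by positivity
  have hexp : ∀ t : ℝ, exp (-|t| / K) = exp (-(2 * k) * |t|) := fun t => by
    congr 1
    rw [hkdef]
    field_simp
  have hσ := sphereArea_pos hd
  have hd0 : (0 : ℝ) < d := by exact_mod_cast (by omega : 0 < d)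
  obtain ⟨Cb, hCb, Hb⟩ := exists_layer_bound hd hk
  obtain ⟨Co, hCo, Ho⟩ := exists_odd_layer_bound hd hk
  obtain ⟨Ce, hCe, He⟩ := exists_even_layer_bound hd hk
  set c := Co * (2 * K) with hc
  set c1 := Co * (4 * K) with hc1
  set c2 := Cb * (4 * K) with hc2
  set c3 := Ce * (K ^ 2 + K) + 4 * sphereArea d with hc3
  have hc0 : 0 ≤ c := by positivity
  have hc10 : 0 ≤ c1 := by positivity
  have hc20 : 0 ≤ c2 := by positivity
  have hc30 : 0 ≤ c3 := by positivity
  set B := c3 + c1 * (1 + 2 * c) + 3 * c2 * (1 + 2 * c ^ 2) + 2 * c +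
        (12 + 12 * c + 8 * c ^ 2) * (2 * c ^ 2) + 1 with hB
  have hB0 : 0 ≤ B := by positivity
  refine ⟨B + 2 * K, by positivity, 1, 0, ?_⟩
  intro L φ hL hφ0 hφ1 rplus hrp hrpL R hR w hw η hη r hr hRr _ α hmean
  obtain ⟨hη0, hη1⟩ := hη
  have hr1 : 1 ≤ r := hR.trans hRr
  have hr0 : 0 < r := by linarith
  have hR0 : 0 ≤ R := by linarith
  have hrL4 : r ≤ L / 4 := by
    refine le_trans ?_ hrpL
    rw [hr, hrp, mul_assoc]
    refine mul_le_of_le_one_left (by positivity) (Real.rpow_le_one hη0 hη1 (by positivity))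
  have hrRL : r + R ≤ L / 2 := by linarith
  have hrleL : r ≤ L := by linarith
  have hrd : r ^ d = η * (φ * d / (2 * sphereArea d)) * L ^ d := by
    rw [hr, mul_pow, mul_pow, ← Real.rpow_natCast, ← Real.rpow_natCast,
      ← Real.rpow_mul hη0, ← Real.rpow_mul (by positivity), one_div,
      inv_mul_cancel₀ hd0.ne', Real.rpow_one, Real.rpow_one]
  have hV : 0 < L ^ d := by positivity
  have hwd : Differentiable ℝ w := hw.1.differentiable (by simp)
  have hwm : Measurable w := hwd.continuous.measurable
  have hwdm : Measurable (deriv w) := measurable_deriv w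
  have hGm : Measurable fun t => Gpot (w t) := by unfold Gpot; fun_prop
  have bh : ∀ s, |w s + Real.sign s| ≤ 2 * K * exp (-(2 * k) * |s|) := fun s => by
    rw [← hexp]; exact hw.abs_add_sign_le hK s
  have b2 : ∀ s, 1 - w s ^ 2 ≤ 4 * K * exp (-(2 * k) * |s|) := fun s => by
    rw [← hexp]; exact hw.one_sub_sq_le hK s
  have b2' : ∀ s, |1 - w s ^ 2| ≤ 4 * K * exp (-(2 * k) * |s|) := fun s => by
    rw [abs_of_nonneg (hw.one_sub_sq_nonneg s)]; exact b2 s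
  have b1 : ∀ s, |w s ^ 3 - w s| ≤ 4 * K * exp (-(2 * k) * |s|) := fun s => by
    have e : w s ^ 3 - w s = -(w s * (1 - w s ^ 2)) := by ring
    rw [e, abs_neg, abs_mul]
    exact (mul_le_of_le_one_left (abs_nonneg _) (hw.2.2.2.1 s)).trans (b2' s)
  have b3 : ∀ s, |deriv w s ^ 2 / 2 + Gpot (w s)| ≤ (K ^ 2 + K) * exp (-(2 * k) * |s|) := by
    intro s
    have h1 : |deriv w s| ≤ K * exp (-(2 * k) * |s|) := by
      rw [← hexp]; exact hw.2.2.2.2.2.2.2 s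
    have h2 : exp (-(2 * k) * |s|) ≤ 1 := Real.exp_le_one_iff.2 (by
      nlinarith [mul_nonneg hk.le (abs_nonneg s)])
    set q := exp (-(2 * k) * |s|)
    have hq : 0 < q := exp_pos _
    have h3 : deriv w s ^ 2 ≤ K ^ 2 * q := by
      rw [← sq_abs]
      calc |deriv w s| ^ 2 ≤ (K * q) ^ 2 := by gcongr
        _ = K ^ 2 * q * q := by ring
        _ ≤ K ^ 2 * q * 1 := by gcongr
        _ = _ := mul_one _
    have h4 : Gpot (w s) ≤ K * q := by
      have := hw.one_sub_sq_nonneg s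
      have h5 : (1 - w s ^ 2) * (1 - w s ^ 2) ≤ 1 * (1 - w s ^ 2) :=
        mul_le_mul_of_nonneg_right (by linarith [sq_nonneg (w s)]) this
      unfold Gpot
      linarith [b2 s]
    have h5 : 0 ≤ Gpot (w s) := by unfold Gpot; positivity
    rw [abs_of_nonneg (by positivity)]
    have : 0 ≤ K ^ 2 * q := by positivity
    linarith
  have hhm : Measurable fun s => w s + Real.sign s := hwm.add measurable_sign_real
  have h1m : Measurable fun s => w s ^ 3 - w s := by fun_prop
  have h2m : Measurable fun s => 1 - w s ^ 2 := by fun_prop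
  have h3m : Measurable fun s => deriv w s ^ 2 / 2 + Gpot (w s) :=
    ((hwdm.pow_const 2).div_const 2).add hGm
  have ih := (integral_Box_layer hd hk (by positivity) hr1 hRr hrRL hhm bh).1
  have i1 := (integral_Box_layer hd hk (by positivity) hr1 hRr hrRL h1m b1).1
  have i2 := (integral_Box_layer hd hk (by positivity) hr1 hRr hrRL h2m b2').1
  have i3 := (integral_Box_layer hd hk (by positivity) hr1 hRr hrRL h3m b3).1
  obtain ⟨is, es⟩ := setIntegral_Box_sign hd hL hr0 (by linarith : r ≤ L / 2)
  have iw : IntegrableOn (fun x : Ed d => w (‖x‖ - r)) (Box d L) := by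
    refine (ih.sub is).congr (Eventually.of_forall fun x => ?_)
    simp
  have ew : ∫ x in Box d L, w (‖x‖ - r) = (-1 + φ) * L ^ d - α * L ^ d := by
    rw [← hmean, integral_add iw (integrableOn_Box_const d hL α), setIntegral_Box_const d hL]
    ring
  have eh : ∫ x in Box d L, (w (‖x‖ - r) + Real.sign (‖x‖ - r)) =
      (φ * (1 - η) - α) * L ^ d := by
    rw [integral_add iw is, ew, es, hrd]
    field_simp
    ring
  have H0 := Ho (2 * K) L r R (by positivity) hr1 hR0 hRr hrRL _ hhm bh (fun s => by
    rw [hw.2.1, Real.sign_neg]; ring)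
  have H1 := Ho (4 * K) L r R (by positivity) hr1 hR0 hRr hrRL _ h1m b1 (fun s => by
    rw [hw.2.1]; ring)
  have H2 := Hb (4 * K) L r R (by positivity) hr1 hR0 hRr hrRL _ h2m b2'
  have H3 := He (K ^ 2 + K) L r R (by positivity) hr1 hR0 hRr hrRL _ h3m b3 (fun s => by
    rw [hw.2.1, hw.deriv_neg, Gpot, neg_sq, ← Gpot])
  have hcore := hw.energy_core hR0
  rw [CHenergy_expand hd hwd hL α i1 i2 i3 iw, ew]
  rw [eh, abs_mul, abs_of_pos hV] at H0
  set I1 := ∫ x in Box d L, (w (‖x‖ - r) ^ 3 - w (‖x‖ - r))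
  set I2 := ∫ x in Box d L, (1 - w (‖x‖ - r) ^ 2)
  set I3 := ∫ x in Box d L, (deriv w (‖x‖ - r) ^ 2 / 2 + Gpot (w (‖x‖ - r)))
  set F := ∫ s in Set.Ioo (-R) R, (deriv w s ^ 2 / 2 + Gpot (w s))
  set X := r ^ (d - 1) * exp (-k * R) with hXdef
  have hX : 0 ≤ X := by positivity
  have hpowle : ∀ m, m ≤ d → r ^ m ≤ L ^ d := fun m hm =>
    (pow_le_pow_left₀ hr0.le hrleL m).trans (pow_le_pow_right₀ (hr1.trans hrleL) hm)
  have hXV : X ≤ L ^ d := by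
    have : exp (-k * R) ≤ 1 := Real.exp_le_one_iff.2 (by nlinarith [mul_nonneg hk.le hR0])
    calc X ≤ r ^ (d - 1) * 1 := by rw [hXdef]; gcongr
      _ ≤ L ^ d := by rw [mul_one]; exact hpowle _ (by omega)
  have hpp : (r ^ (d - 2)) ^ 2 ≤ L ^ d * r ^ (d - 3) := by
    calc (r ^ (d - 2)) ^ 2 = r ^ ((d - 2) * 2) := by rw [pow_mul]
      _ ≤ r ^ (d + (d - 3)) := pow_le_pow_right₀ hr1 (by omega)
      _ = r ^ d * r ^ (d - 3) := pow_add ..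
      _ ≤ L ^ d * r ^ (d - 3) := by gcongr
  have hD3 : |I3 - c₀ * sphereArea d * r ^ (d - 1)| ≤ c3 * (r ^ (d - 3) + X) := by
    have e : I3 - c₀ * sphereArea d * r ^ (d - 1) =
      (I3 - sphereArea d * r ^ (d - 1) * F) + sphereArea d * r ^ (d - 1) * (F - c₀) := by ring
    have hk1 : k ≤ 1 := by
      rw [hkdef, div_le_one (by positivity)]; linarith
    have h1 : exp (-R) ≤ exp (-k * R) := Real.exp_le_exp.2 (by nlinarith)
    have h2 : |sphereArea d * r ^ (d - 1) * (F - c₀)| ≤ 4 * sphereArea d * X := by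
      rw [abs_mul, abs_of_nonneg (by positivity)]
      calc sphereArea d * r ^ (d - 1) * |F - c₀|
          ≤ sphereArea d * r ^ (d - 1) * (4 * exp (-k * R)) := by
            gcongr
            linarith
        _ = _ := by rw [hXdef]; ring
    have h3 : 0 ≤ 4 * sphereArea d * r ^ (d - 3) := by positivity
    rw [e]
    refine (abs_add_le _ _).trans ?_
    calc _ ≤ Ce * (K ^ 2 + K) * (r ^ (d - 3) + X) + 4 * sphereArea d * X := add_le_add H3 h2
      _ ≤ _ := by rw [hc3]; linarith
  have hδ : |α - φ * (1 - η)| * L ^ d ≤ c * (r ^ (d - 2) + X) := by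
    rw [abs_sub_comm]; exact H0
  have ha0 : 0 ≤ φ * (1 - η) := mul_nonneg hφ0.le (by linarith)
  have hmain := expansion_algebra hc0 hc10 hc20 hc30 ha0
    (mul_le_one₀ hφ1.le (by linarith) (by linarith) : φ * (1 - η) ≤ 1)
    (mul_nonneg hφ0.le hη0 : 0 ≤ φ * η) (mul_le_one₀ hφ1.le hη0 hη1) hV hX
    (by positivity) (by positivity) (by positivity) (hpowle (d - 1) (by omega))
    (hpowle (d - 2) (by omega)) hXV hpp hδ H1 H2 hD3
  rw [← hB] at hmain
  have hXC : X ≤ r ^ (d - 1) * exp (-R / (B + 2 * K)) := by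
    rw [hXdef]
    gcongr
    rw [neg_mul, neg_div, neg_le_neg_iff, hkdef, one_div, ← div_eq_inv_mul]
    gcongr
    linarith
  have hS0 : 0 ≤ φ * (1 - η) * r ^ (d - 2) + φ ^ 2 * (1 - η) ^ 2 * r ^ (d - 1) +
      φ ^ 4 * η * (1 - η) ^ 3 * L ^ d + r ^ (d - 3) := by
    have : 0 ≤ 1 - η := by linarith
    positivity
  refine (le_of_eq (congrArg abs ?_)).trans (hmain.trans ?_)
  · ring
  calc B * (X + φ * (1 - η) * r ^ (d - 2) + (φ * (1 - η)) ^ 2 * r ^ (d - 1) +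
        L ^ d * (φ * η) * (φ * (1 - η)) ^ 3 + r ^ (d - 3))
      = B * (X + (φ * (1 - η) * r ^ (d - 2) + φ ^ 2 * (1 - η) ^ 2 * r ^ (d - 1) +
        φ ^ 4 * η * (1 - η) ^ 3 * L ^ d + r ^ (d - 3))) := by ring
    _ ≤ (B + 2 * K) * (r ^ (d - 1) * exp (-R / (B + 2 * K)) +
        (φ * (1 - η) * r ^ (d - 2) + φ ^ 2 * (1 - η) ^ 2 * r ^ (d - 1) +
        φ ^ 4 * η * (1 - η) ^ 3 * L ^ d + r ^ (d - 3))) := by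
        gcongr
        linarith
    _ = _ := by ring
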